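/- arXiv:2406.06749 — 4 statements merged into one kernel-verified Lean document; each statement's English description precedes it below -/
import Mathlib

section
/- Let n, d be positive integers, D ≥ 0, let C ⊆ (ℝ^d)^n be a Borel set, and let S : C → ℝ be a Borel measurable map that is D-Lipschitz with respect to the Hamming distance on (ℝ^d)^n, i.e. |S(x) − S(x')| ≤ D · d_H(x, x') for all x, x' ∈ C. Then there exists a Borel measurable map S̃ : (ℝ^d)^n → ℝ that is D-Lipschitz with respect to the Hamming distance on all of (ℝ^d)^n and satisfies S̃(x) = S(x) for every x ∈ C. -/
noncomputable section

/-- Hamming distance between two tuples. -/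
def hammingD {α : Type*} {n : ℕ} (x x' : Fin n → α) : ℕ := Set.ncard { i | x i ≠ x' i }

open MeasureTheory

/-- Borel interpolation between a supremum and an infimum of measurable functions over
(possibly uncountable) standard Borel parameter spaces, via Lusin separation. -/
theorem exists_measurable_between {X Y Z : Type*}
    [TopologicalSpace X] [PolishSpace X] [MeasurableSpace X] [BorelSpace X]
    [MeasurableSpace Y] [StandardBorelSpace Y] [Nonempty Y]
    [MeasurableSpace Z] [StandardBorelSpace Z] [Nonempty Z]
    {l : X × Y → ℝ} {u : X × Z → ℝ} (hl : Measurable l) (hu : Measurable u)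
    (hlu : ∀ x y z, l (x, y) ≤ u (x, z)) :
    ∃ g : X → ℝ, Measurable g ∧ (∀ x y, l (x, y) ≤ g x) ∧ ∀ x z, g x ≤ u (x, z) := by
  have separated (q : ℚ) : MeasurablySeparable
      (Prod.fst '' {p : X × Y | (q : ℝ) < l p}) (Prod.fst '' {p : X × Z | u p < (q : ℝ)}) := by
    apply AnalyticSet.measurablySeparable
    · exact (measurableSet_lt measurable_const hl).analyticSet_image measurable_fst
    · exact (measurableSet_lt hu measurable_const).analyticSet_image measurable_fst
    · rw [Set.disjoint_left]
      rintro _ ⟨⟨x, y⟩, hxy, rfl⟩ ⟨⟨x', z⟩, hxz, rfl⟩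
      exact absurd (hlu x' y z) (not_le.2 (lt_trans hxz hxy))
  choose B hlB hBu hB using separated
  classical
  obtain ⟨y₀⟩ := ‹Nonempty Y›
  obtain ⟨z₀⟩ := ‹Nonempty Z›
  let approx (q : ℚ) (x : X) : ℝ := if x ∈ B q then (q : ℝ) else l (x, y₀)
  have approx_le (q : ℚ) (x : X) (z : Z) : approx q x ≤ u (x, z) := by
    by_cases hx : x ∈ B q
    · simp only [approx, if_pos hx]
      by_contra! hlt
      exact Set.disjoint_left.1 (hBu q) ⟨(x, z), hlt, rfl⟩ hx
    · simpa only [approx, if_neg hx] using hlu x y₀ z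
  have bdd (x : X) : BddAbove (Set.range fun q => approx q x) :=
    ⟨u (x, z₀), by rintro _ ⟨q, rfl⟩; exact approx_le q x z₀⟩
  refine ⟨fun x => ⨆ q, approx q x, ?_, fun x y => ?_, fun x z => ciSup_le fun q => approx_le q x z⟩
  · exact Measurable.iSup fun q =>
      Measurable.ite (hB q) measurable_const (hl.comp (measurable_id.prodMk measurable_const))
  · refine le_of_forall_rat_lt_imp_le fun q hq => ?_
    have hx : x ∈ B q := hlB q ⟨(x, y), hq, rfl⟩
    simpa only [approx, if_pos hx] using le_ciSup (bdd x) q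

theorem hammingD_eq_hammingDist {α : Type*} [DecidableEq α] {n : ℕ} (x y : Fin n → α) :
    hammingD x y = hammingDist x y := by
  simp [hammingD, hammingDist, Set.ncard_eq_toFinset_card']

theorem hammingD_self {α : Type*} {n : ℕ} (x : Fin n → α) : hammingD x x = 0 := by
  simp [hammingD]

theorem hammingD_comm {α : Type*} {n : ℕ} (x y : Fin n → α) : hammingD x y = hammingD y x := by
  simp only [hammingD, ne_comm]

theorem hammingD_triangle {α : Type*} {n : ℕ} (x y z : Fin n → α) :
    hammingD x z ≤ hammingD x y + hammingD y z := by
  classical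
  simpa only [hammingD_eq_hammingDist] using hammingDist_triangle x y z

theorem Measurable.hammingD {α β : Type*} [MeasurableSpace α] [MeasurableEq α]
    [MeasurableSpace β] {n : ℕ} {f g : β → Fin n → α} (hf : Measurable f) (hg : Measurable g) :
    Measurable fun b => (hammingD (f b) (g b) : ℝ) := by
  classical
  simp only [hammingD_eq_hammingDist, hammingDist, Finset.card_filter, Nat.cast_sum]
  refine Finset.measurable_sum _ fun i _ => ?_
  simp only [Nat.cast_ite]
  refine Measurable.ite ?_ measurable_const measurable_const
  exact (measurableSet_eq_fun (by fun_prop) (by fun_prop)).compl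

/-- McShane extension for the Hamming distance over a Polish alphabet, keeping Borel
measurability. -/
theorem exists_measurable_hammingD_lipschitz_extension {α : Type*} [TopologicalSpace α]
    [PolishSpace α] [MeasurableSpace α] [BorelSpace α] {n : ℕ} {D : ℝ} (hD : 0 ≤ D)
    {C : Set (Fin n → α)} (hC : MeasurableSet C) {S : C → ℝ} (hSmeas : Measurable S)
    (hSlip : ∀ x y : C, |S x - S y| ≤ D * hammingD (x : Fin n → α) (y : Fin n → α)) :
    ∃ S' : (Fin n → α) → ℝ, Measurable S' ∧ (∀ x y, |S' x - S' y| ≤ D * hammingD x y) ∧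
      ∀ x : C, S' x = S x := by
  rcases isEmpty_or_nonempty C with hempty | hne
  · refine ⟨fun _ => 0, measurable_const, fun x y => ?_, fun x => hempty.elim x⟩
    rw [sub_self, abs_zero]
    exact mul_nonneg hD (Nat.cast_nonneg _)
  have : StandardBorelSpace C := hC.standardBorel
  have : Nonempty (Fin n → α) := hne.map Subtype.val
  have triangle (x y z : Fin n → α) :
      D * hammingD x z ≤ D * hammingD x y + D * hammingD y z := by
    rw [← mul_add]
    exact mul_le_mul_of_nonneg_left (mod_cast hammingD_triangle x y z) hD
  have hdC : Measurable fun p : (Fin n → α) × C => (hammingD p.1 p.2 : ℝ) :=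
    measurable_fst.hammingD (measurable_subtype_coe.comp measurable_snd)
  have hupper : Measurable fun p : (Fin n → α) × C => S p.2 + D * hammingD p.1 p.2 :=
    (hSmeas.comp measurable_snd).add (hdC.const_mul D)
  have hlower : Measurable fun p : (Fin n → α) × C => S p.2 - D * hammingD p.1 p.2 :=
    (hSmeas.comp measurable_snd).sub (hdC.const_mul D)
  obtain ⟨f₀, hf₀, hlf₀, hf₀u⟩ := exists_measurable_between hlower hupper fun x y z => by
    have h₁ := (abs_le.1 (hSlip y z)).2
    have h₂ := triangle y x z
    rw [hammingD_comm (y : Fin n → α) x] at h₂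
    simp only
    linarith
  let Admissible := {f : (Fin n → α) → ℝ //
    Measurable f ∧ ∀ (x) (z : C), f x ≤ S z + D * hammingD x z}
  have step (f : Admissible) : ∃ g : Admissible, ∀ x y, f.1 y - D * hammingD x y ≤ g.1 x := by
    have hl : Measurable fun p : (Fin n → α) × (Fin n → α) =>
        f.1 p.2 - D * hammingD p.1 p.2 :=
      (f.2.1.comp measurable_snd).sub ((measurable_fst.hammingD measurable_snd).const_mul D)
    obtain ⟨g, hg, hlg, hgu⟩ := exists_measurable_between hl hupper fun x y z => by
      have h₁ := f.2.2 y z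
      have h₂ := triangle y x z
      rw [hammingD_comm y x] at h₂
      simp only
      linarith
    exact ⟨⟨g, hg, hgu⟩, hlg⟩
  choose next hnext using step
  obtain ⟨F, hF₀, hF⟩ : ∃ F : ℕ → Admissible, (∀ x, (F 0).1 x = f₀ x) ∧
      ∀ k x y, (F k).1 y - D * hammingD x y ≤ (F (k + 1)).1 x := by
    refine ⟨fun k => next^[k] ⟨f₀, hf₀, hf₀u⟩, fun x => rfl, fun k x y => ?_⟩
    simp only [Function.iterate_succ_apply']
    exact hnext _ x y
  have bdd (x) : BddAbove (Set.range fun k => (F k).1 x) := by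
    obtain ⟨z⟩ := hne
    exact ⟨_, by rintro _ ⟨k, rfl⟩; exact (F k).2.2 x z⟩
  have hlip (x y) : (⨆ k, (F k).1 y) ≤ (⨆ k, (F k).1 x) + D * hammingD x y :=
    ciSup_le fun k => by linarith [hF k x y, le_ciSup (bdd x) (k + 1)]
  refine ⟨fun x => ⨆ k, (F k).1 x, Measurable.iSup fun k => (F k).2.1, fun x y => ?_, fun x => ?_⟩
  · have h := hlip y x
    rw [hammingD_comm y x] at h
    exact abs_le.2 ⟨by linarith [hlip x y], by linarith⟩
  · apply le_antisymm
    · exact ciSup_le fun k => by simpa [hammingD_self] using (F k).2.2 x x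
    · refine le_trans ?_ (le_ciSup (bdd x) 0)
      simpa [hammingD_self, hF₀] using hlf₀ x x

/-- **Measurable Lipschitz extension with respect to the Hamming distance**
(McShane-Whitney extension, Borel-measurable version): a Borel measurable map defined on a
Borel subset `C ⊆ (ℝ^d)^n` that is `D`-Lipschitz for the Hamming distance extends to a Borel
measurable map on all of `(ℝ^d)^n` that is `D`-Lipschitz for the Hamming distance. -/
theorem measurable_hamming_lipschitz_extension
    (n d : ℕ) (D : ℝ) (hD : 0 ≤ D)
    (C : Set (Fin n → (Fin d → ℝ))) (hC : MeasurableSet C)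
    (S : C → ℝ) (hSmeas : Measurable S)
    (hSlip : ∀ x y : C, |S x - S y| ≤ D * hammingD (x : Fin n → (Fin d → ℝ)) (y : Fin n → (Fin d → ℝ))) :
    ∃ S' : (Fin n → (Fin d → ℝ)) → ℝ, Measurable S' ∧
      (∀ x y, |S' x - S' y| ≤ D * hammingD x y) ∧
      ∀ x : C, S' x = S x := by
  exact exists_measurable_hammingD_lipschitz_extension hD hC hSmeas hSlip

end
end

section
/- Let 𝒳 be a measurable space with measurable diagonal (e.g. a standard Borel space), 𝒴 a measurable space, n a positive integer, 0 ≤ ε ≤ 1, δ ≥ 0 and p ∈ [0,1]. Let K be a Markov kernel from 𝒳^n to 𝒴 that is (ε,δ)-differentially private. Let P_1, P_2 be probability measures on 𝒳, and suppose ℙ is a probability measure on 𝒳^n × 𝒳^n, with coordinates written (X̃, X) = ((X̃_1,…,X̃_n),(X_1,…,X_n)), whose first marginal is P_1^{⊗n} and second marginal is P_2^{⊗n}, and under which the indicator variables D_i = 1{X̃_i ≠ X_i}, i = 1,…,n, are i.i.d. Bernoulli(p). Then for every measurable A ⊆ 𝒴: ∫ K(A|x̃) dP_1^{⊗n}(x̃)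 ≤ e^{4εnp} ∫ K(A|x) dP_2^{⊗n}(x) + 2δ · E[S e^{εS}], where S is a Binomial(n,p) random variable. -/
open MeasureTheory ProbabilityTheory

noncomputable section

/-- A Markov kernel from `𝒳^n` to `𝒴` is `(ε,δ)`-differentially private if
`K(A|x) ≤ e^ε K(A|x') + δ` for all neighboring data sets `x, x'`. -/
def IsDPKernel {𝒳 𝒴 : Type*} [MeasurableSpace 𝒳] [MeasurableSpace 𝒴] {n : ℕ}
    (ε δ : ℝ) (K : Kernel (Fin n → 𝒳) 𝒴) : Prop :=
  ∀ x x' : Fin n → 𝒳, hammingD x x' ≤ 1 → ∀ A : Set 𝒴, MeasurableSet A →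
    K x A ≤ ENNReal.ofReal (Real.exp ε) * K x' A + ENNReal.ofReal δ

lemma hammingD_update_le_one {α : Type*} {n : ℕ} (x : Fin n → α) (i : Fin n) (a : α) :
    hammingD x (Function.update x i a) ≤ 1 := by
  refine (Set.ncard_le_ncard (t := {i}) ?_ (Set.finite_singleton i)).trans
    (Set.ncard_singleton i).le
  intro j hj
  by_contra hne
  exact hj (Function.update_of_ne hne a x).symm

/-- If all values of `h` are within a factor `1 + s` and a summand `d` of each other, then replacing
a component of mass `p` in a probability measure changes `∫ h` by at most a factor `1 + p s` and a
summand `p d`. -/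
lemma lintegral_add_le_of_forall_le {α : Type*} [MeasurableSpace α] [Nonempty α]
    {h : α → ENNReal} {s d : ENNReal} (hs : s ≠ ⊤) (hh : ∀ x y, h x ≤ (1 + s) * h y + d)
    {μ₀ μ₁ ν₁ : Measure α} {p : ENNReal} (hμ₁ : μ₁ Set.univ = p) (hν₁ : ν₁ Set.univ = p)
    (htot : (μ₀ + ν₁) Set.univ = 1) :
    ∫⁻ x, h x ∂(μ₀ + μ₁) ≤ (1 + p * s) * ∫⁻ x, h x ∂(μ₀ + ν₁) + p * d := by
  set m := ⨅ y, h y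
  have upper (x : α) : h x ≤ (1 + s) * m + d := by
    rw [ENNReal.mul_iInf_of_ne (by simp) (by simp [hs]), ENNReal.iInf_add]
    exact le_iInf (hh x)
  have lower (μ : Measure α) : m * μ Set.univ ≤ ∫⁻ x, h x ∂μ := by
    rw [← lintegral_const]
    exact lintegral_mono fun x => iInf_le h x
  have upper₁ : ∫⁻ x, h x ∂μ₁ ≤ ((1 + s) * m + d) * p := by
    rw [← hμ₁, ← lintegral_const]
    exact lintegral_mono upper
  have lower₁ := lower ν₁
  have lower_tot := lower (μ₀ + ν₁)
  rw [hν₁] at lower₁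
  rw [htot, mul_one] at lower_tot
  calc ∫⁻ x, h x ∂(μ₀ + μ₁) ≤ ∫⁻ x, h x ∂μ₀ + ((1 + s) * m + d) * p := by
        rw [lintegral_add_measure]
        gcongr
    _ = (∫⁻ x, h x ∂μ₀ + m * p) + p * s * m + p * d := by ring
    _ ≤ ∫⁻ x, h x ∂(μ₀ + ν₁) + p * s * ∫⁻ x, h x ∂(μ₀ + ν₁) + p * d := by
        gcongr
        rw [lintegral_add_measure]
        gcongr
    _ = _ := by ring

lemma lintegral_pi_fin_succ {α : Type*} [MeasurableSpace α] (P : Measure α)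
    [IsProbabilityMeasure P] {n : ℕ} {g : (Fin (n + 1) → α) → ENNReal} (hg : Measurable g) :
    ∫⁻ x, g x ∂(Measure.pi fun _ => P) =
      ∫⁻ a, ∫⁻ r, g (Fin.cons a r) ∂(Measure.pi fun _ => P) ∂P := by
  have e := measurePreserving_piFinSuccAbove (fun _ : Fin (n + 1) => P) 0
  rw [← (e.symm _).lintegral_comp hg, lintegral_prod]
  · simp [MeasurableEquiv.piFinSuccAbove, Fin.insertNthEquiv]
  · exact (hg.comp (MeasurableEquiv.measurable _)).aemeasurable

lemma measurable_fin_cons {α : Type*} [MeasurableSpace α] {n : ℕ} :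
    Measurable fun z : α × (Fin n → α) => (Fin.cons z.1 z.2 : Fin (n + 1) → α) := by
  refine measurable_pi_lambda _ fun i => ?_
  refine Fin.cases ?_ (fun j => ?_) i
  · simpa using measurable_fst
  · exact (measurable_pi_apply j).comp measurable_snd

/-- A one-coordinate comparison of two probability measures tensorizes. -/
lemma lintegral_pi_le_of_forall_update_le {α : Type*} [MeasurableSpace α]
    {P₁ P₂ : Measure α} [IsProbabilityMeasure P₁] [IsProbabilityMeasure P₂] {c e d b : ENNReal}
    (hc : 1 ≤ c)
    (hstep : ∀ h : α → ENNReal, (∀ x y, h x ≤ e * h y + d) →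
      ∫⁻ x, h x ∂P₁ ≤ c * ∫⁻ x, h x ∂P₂ + b)
    {n : ℕ} {g : (Fin n → α) → ENNReal} (hg : Measurable g)
    (hgd : ∀ x i a, g x ≤ e * g (Function.update x i a) + d) :
    ∫⁻ x, g x ∂(Measure.pi fun _ => P₁) ≤
      c ^ n * ∫⁻ x, g x ∂(Measure.pi fun _ => P₂) + n * b * c ^ (n - 1) := by
  induction n with
  | zero =>
    have hconst (x : Fin 0 → α) : g x = g default := congrArg g (Subsingleton.elim x default)
    simp [hconst]
  | succ n ih =>
    have hcons (a : α) : Measurable fun r : Fin n → α => g (Fin.cons a r) :=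
      hg.comp (measurable_fin_cons.comp measurable_prodMk_left)
    rw [lintegral_pi_fin_succ P₁ hg, lintegral_pi_fin_succ P₂ hg]
    set h : α → ENNReal := fun a => ∫⁻ r, g (Fin.cons a r) ∂(Measure.pi fun _ : Fin n => P₂)
    have hh (x y : α) : h x ≤ e * h y + d := by
      calc h x ≤ ∫⁻ r, (e * g (Fin.cons y r) + d) ∂(Measure.pi fun _ : Fin n => P₂) :=
            lintegral_mono fun r => by
              simpa [Fin.update_cons_zero] using hgd (Fin.cons x r) 0 y
        _ = e * h y + d := by
            rw [lintegral_add_right _ measurable_const, lintegral_const_mul _ (hcons y)]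
            simp [h]
    have hhm : Measurable h := (hg.comp measurable_fin_cons).lintegral_prod_right'
    calc ∫⁻ a, ∫⁻ r, g (Fin.cons a r) ∂(Measure.pi fun _ => P₁) ∂P₁
        ≤ ∫⁻ a, (c ^ n * h a + n * b * c ^ (n - 1)) ∂P₁ :=
          lintegral_mono fun a => ih (hcons a) fun x i y => by
            simpa [Fin.cons_update] using hgd (Fin.cons a x) i.succ y
      _ = c ^ n * ∫⁻ a, h a ∂P₁ + n * b * c ^ (n - 1) := by
          rw [lintegral_add_right _ measurable_const, lintegral_const_mul _ hhm]
          simp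
      _ ≤ c ^ n * (c * ∫⁻ a, h a ∂P₂ + b) + n * b * c ^ n := by
          gcongr ?_ + _ * ?_
          · gcongr
            exact hstep h hh
          · exact pow_le_pow_right₀ hc (Nat.sub_le n 1)
      _ = _ := by
          simp only [Nat.cast_add, Nat.cast_one, Nat.add_sub_cancel]
          ring

/-- Two measures that are marginals of a coupling share the component carried by the diagonal. -/
lemma exists_common_component {Ω α : Type*} [MeasurableSpace Ω] [MeasurableSpace α]
    (hdiag : MeasurableSet {z : α × α | z.1 = z.2}) (μ : Measure Ω)
    {X Y : Ω → α} (hX : Measurable X) (hY : Measurable Y) :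
    ∃ μ₀ μ₁ ν₁ : Measure α, μ.map X = μ₀ + μ₁ ∧ μ.map Y = μ₀ + ν₁ ∧
      μ₁ Set.univ = μ {ω | X ω ≠ Y ω} ∧ ν₁ Set.univ = μ {ω | X ω ≠ Y ω} := by
  have hE : MeasurableSet {ω | X ω = Y ω} := (hX.prodMk hY) hdiag
  have hcongr : (μ.restrict {ω | X ω = Y ω}).map X = (μ.restrict {ω | X ω = Y ω}).map Y :=
    Measure.map_congr (ae_restrict_mem hE)
  have mass {Z : Ω → α} (hZ : Measurable Z) :
      (μ.restrict {ω | X ω = Y ω}ᶜ).map Z Set.univ = μ {ω | X ω ≠ Y ω} := by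
    rw [Measure.map_apply hZ MeasurableSet.univ, Set.preimage_univ, Measure.restrict_apply_univ]
    rfl
  refine ⟨(μ.restrict {ω | X ω = Y ω}).map X, _, _, ?_, ?_, mass hX, mass hY⟩
  · rw [← Measure.map_add _ _ hX, Measure.restrict_add_restrict_compl hE]
  · rw [hcongr, ← Measure.map_add _ _ hY, Measure.restrict_add_restrict_compl hE]

lemma sum_range_mul_choose_mul_pow (x y : ℝ) (n : ℕ) :
    ∑ k ∈ Finset.range (n + 1), (k : ℝ) * n.choose k * x ^ k * y ^ (n - k) =
      n * x * (x + y) ^ (n - 1) := by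
  cases n with
  | zero => simp
  | succ m =>
    rw [Finset.sum_range_succ', add_pow, Finset.mul_sum]
    simp only [Nat.cast_zero, zero_mul, add_zero, Nat.add_sub_cancel]
    refine Finset.sum_congr rfl fun k _ => ?_
    have hchoose : ((m + 1 : ℕ) : ℝ) * m.choose k = (m + 1).choose (k + 1) * (k + 1 : ℕ) := by
      exact_mod_cast Nat.add_one_mul_choose_eq m k
    rw [Nat.add_sub_add_right]
    linear_combination (-(x ^ (k + 1) * y ^ (m - k))) * hchoose

/-- **Coupling transfer for differentially private kernels**: if `(X̃, X)` is a coupling of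
`P₁^{⊗n}` and `P₂^{⊗n}` under which the disagreement indicators are i.i.d. Bernoulli(p), then
for an `(ε,δ)`-DP Markov kernel `K` with `ε ≤ 1`,
`P₁^n K(A) ≤ e^{4εnp} P₂^n K(A) + 2δ E[S e^{εS}]` with `S ~ Bin(n,p)`. -/
theorem dp_kernel_coupling_transfer
    {𝒳 𝒴 : Type*} [MeasurableSpace 𝒳] [MeasurableSpace 𝒴]
    (hdiag : MeasurableSet { z : 𝒳 × 𝒳 | z.1 = z.2 })
    (n : ℕ) (hn : 0 < n) (ε δ : ℝ) (hε0 : 0 ≤ ε) (hε1 : ε ≤ 1) (hδ : 0 ≤ δ)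
    (pp : ℝ) (hp0 : 0 ≤ pp) (hp1 : pp ≤ 1)
    (K : Kernel (Fin n → 𝒳) 𝒴) (hmk : IsMarkovKernel K) (hK : IsDPKernel ε δ K)
    (P₁ P₂ : Measure 𝒳) (h1 : IsProbabilityMeasure P₁) (h2 : IsProbabilityMeasure P₂)
    (Pcpl : Measure ((Fin n → 𝒳) × (Fin n → 𝒳))) (hprob : IsProbabilityMeasure Pcpl)
    (hfst : Pcpl.map Prod.fst = Measure.pi fun _ : Fin n => P₁)
    (hsnd : Pcpl.map Prod.snd = Measure.pi fun _ : Fin n => P₂)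
    (hindep : iIndepSet (fun i : Fin n => { z | z.1 i ≠ z.2 i }) Pcpl)
    (hbern : ∀ i : Fin n, Pcpl { z | z.1 i ≠ z.2 i } = ENNReal.ofReal pp) :
    ∀ A : Set 𝒴, MeasurableSet A →
      (∫⁻ x, K x A ∂(Measure.pi fun _ : Fin n => P₁)) ≤
        ENNReal.ofReal (Real.exp (4 * ε * n * pp)) *
            (∫⁻ x, K x A ∂(Measure.pi fun _ : Fin n => P₂)) +
          ENNReal.ofReal (2 * δ *
            (∑ k ∈ Finset.range (n + 1),
              (k : ℝ) * Real.exp (ε * k) * (n.choose k) * pp ^ k * (1 - pp) ^ (n - k))) := by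
  intro A hA
  set s := Real.exp ε - 1 with hs_def
  have hs0 : 0 ≤ s := by linarith [Real.one_le_exp hε0]
  have hs2 : s ≤ 2 * ε := by
    have := Real.abs_exp_sub_one_le (x := ε) (by rwa [abs_of_nonneg hε0])
    rw [abs_of_nonneg hε0] at this
    exact (le_abs_self _).trans this
  have hps : 0 ≤ pp * s := mul_nonneg hp0 hs0
  let i₀ : Fin n := ⟨0, hn⟩
  have hX : Measurable fun z : (Fin n → 𝒳) × (Fin n → 𝒳) => z.1 i₀ :=
    (measurable_pi_apply i₀).comp measurable_fst
  have hY : Measurable fun z : (Fin n → 𝒳) × (Fin n → 𝒳) => z.2 i₀ :=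
    (measurable_pi_apply i₀).comp measurable_snd
  have hmapX : Pcpl.map (fun z => z.1 i₀) = P₁ := by
    rw [← (measurePreserving_eval (fun _ : Fin n => P₁) i₀).map_eq, ← hfst,
      Measure.map_map (measurable_pi_apply i₀) measurable_fst]
    rfl
  have hmapY : Pcpl.map (fun z => z.2 i₀) = P₂ := by
    rw [← (measurePreserving_eval (fun _ : Fin n => P₂) i₀).map_eq, ← hsnd,
      Measure.map_map (measurable_pi_apply i₀) measurable_snd]
    rfl
  obtain ⟨μ₀, μ₁, ν₁, hP₁, hP₂, hμ₁, hν₁⟩ := exists_common_component hdiag Pcpl hX hY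
  rw [hmapX] at hP₁
  rw [hmapY] at hP₂
  rw [hbern i₀] at hμ₁ hν₁
  have hne : Nonempty 𝒳 := nonempty_of_isProbabilityMeasure P₁
  have hexp : ENNReal.ofReal (Real.exp ε) = 1 + ENNReal.ofReal s := by
    rw [← ENNReal.ofReal_one, ← ENNReal.ofReal_add zero_le_one hs0]
    congr 1
    ring
  have hmain := lintegral_pi_le_of_forall_update_le (P₁ := P₁) (P₂ := P₂)
    (c := 1 + ENNReal.ofReal pp * ENNReal.ofReal s) (e := 1 + ENNReal.ofReal s)
    (d := ENNReal.ofReal δ) (b := ENNReal.ofReal pp * ENNReal.ofReal δ) le_self_add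
    (fun h hh => by
      have htot : (μ₀ + ν₁) Set.univ = 1 := by rw [← hP₂]; exact measure_univ
      simpa only [← hP₁, ← hP₂] using
        lintegral_add_le_of_forall_le ENNReal.ofReal_ne_top hh hμ₁ hν₁ htot)
    (K.measurable_coe hA)
    (fun x i a => hexp ▸ hK x _ (hammingD_update_le_one x i a) A hA)
  have hc : 1 + ENNReal.ofReal pp * ENNReal.ofReal s = ENNReal.ofReal (1 + pp * s) := by
    rw [ENNReal.ofReal_add zero_le_one hps, ENNReal.ofReal_one, ENNReal.ofReal_mul hp0]
  have hc0 : 0 ≤ 1 + pp * s := by positivity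
  rw [hc, ← ENNReal.ofReal_pow hc0, ← ENNReal.ofReal_pow hc0, ← ENNReal.ofReal_mul hp0,
    ← ENNReal.ofReal_natCast, ← ENNReal.ofReal_mul (Nat.cast_nonneg n),
    ← ENNReal.ofReal_mul (by positivity)] at hmain
  refine hmain.trans ?_
  gcongr ENNReal.ofReal ?_ * _ + ENNReal.ofReal ?_
  · calc (1 + pp * s) ^ n ≤ Real.exp (pp * s) ^ n := by
          gcongr
          linarith [Real.add_one_le_exp (pp * s)]
      _ = Real.exp (n * (pp * s)) := (Real.exp_nat_mul _ _).symm
      _ ≤ Real.exp (n * (pp * (4 * ε))) := by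
          gcongr
          linarith
      _ = _ := by ring_nf
  · have hsum : ∑ k ∈ Finset.range (n + 1),
        (k : ℝ) * Real.exp (ε * k) * (n.choose k) * pp ^ k * (1 - pp) ^ (n - k) =
          n * (pp * Real.exp ε) * (1 + pp * s) ^ (n - 1) := by
      rw [show 1 + pp * s = pp * Real.exp ε + (1 - pp) by rw [hs_def]; ring,
        ← sum_range_mul_choose_mul_pow]
      refine Finset.sum_congr rfl fun k _ => ?_
      rw [mul_pow, ← Real.exp_nat_mul, mul_comm ε]
      ring
    rw [hsum]
    have hT : 0 ≤ n * (pp * δ) * (1 + pp * s) ^ (n - 1) := by positivity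
    nlinarith [mul_le_mul_of_nonneg_left (Real.one_le_exp hε0) hT]

end
end

section
/- Let K be a Markov kernel from 𝒳^n to a measurable space 𝒴 satisfying an (ε,δ)-differential-privacy constraint, let A ⊆ 𝒴 be a measurable set, and let μ be a probability measure on 𝒴. Define K̃(B|x) := K(B ∩ A | x) + K(A^c | x) · μ(B) for x ∈ 𝒳^n and measurable B ⊆ 𝒴. Then K̃ is a Markov kernel from 𝒳^n to 𝒴 satisfying an (ε, 2δ)-differential-privacy constraint. -/
open MeasureTheory ProbabilityTheory

noncomputable section

/-- **Restriction-and-redistribution of a DP kernel**: given an `(ε,δ)`-DP Markov kernel `K`,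
a measurable set `A` and a probability measure `μ`, the kernel
`K̃(B|x) = K(B ∩ A|x) + K(Aᶜ|x) μ(B)` is a Markov kernel satisfying `(ε, 2δ)`-DP. -/
theorem dp_kernel_restriction_redistribution
    {𝒳 𝒴 : Type*} [MeasurableSpace 𝒳] [MeasurableSpace 𝒴] (n : ℕ)
    (ε δ : ℝ) (hε : 0 ≤ ε) (hδ : 0 ≤ δ)
    (K : Kernel (Fin n → 𝒳) 𝒴) (hmk : IsMarkovKernel K) (hK : IsDPKernel ε δ K)
    (A : Set 𝒴) (hA : MeasurableSet A)
    (μ : Measure 𝒴) (hμ : IsProbabilityMeasure μ) :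
    ∃ K' : Kernel (Fin n → 𝒳) 𝒴, IsMarkovKernel K' ∧
      (∀ x, ∀ B : Set 𝒴, MeasurableSet B → K' x B = K x (B ∩ A) + K x Aᶜ * μ B) ∧
      IsDPKernel ε (2 * δ) K' := by
  have apply_eq : ∀ x, ∀ B : Set 𝒴, MeasurableSet B →
      ((K x).restrict A + K x Aᶜ • μ) B = K x (B ∩ A) + K x Aᶜ * μ B := fun x B hB ↦ by
    simp [Measure.restrict_apply hB]
  refine ⟨⟨fun x ↦ (K x).restrict A + K x Aᶜ • μ,
    Measure.measurable_of_measurable_coe _ fun B hB ↦ ?_⟩, ⟨fun x ↦ ⟨?_⟩⟩, apply_eq, ?_⟩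
  · simp only [apply_eq _ B hB]
    exact (K.measurable_coe (hB.inter hA)).add ((K.measurable_coe hA.compl).mul_const _)
  · refine (apply_eq x _ .univ).trans ?_
    rw [Set.univ_inter, measure_univ, mul_one, prob_add_prob_compl hA]
  · intro x x' hx B hB
    refine (apply_eq x B hB).trans_le (le_of_le_of_eq ?_
      (congrArg (ENNReal.ofReal (Real.exp ε) * · + ENNReal.ofReal (2 * δ))
        (apply_eq x' B hB).symm))
    calc K x (B ∩ A) + K x Aᶜ * μ B
        ≤ (ENNReal.ofReal (Real.exp ε) * K x' (B ∩ A) + ENNReal.ofReal δ)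
          + (ENNReal.ofReal (Real.exp ε) * K x' Aᶜ + ENNReal.ofReal δ) * μ B := by
          gcongr
          · exact hK x x' hx _ (hB.inter hA)
          · exact hK x x' hx _ hA.compl
      _ = ENNReal.ofReal (Real.exp ε) * (K x' (B ∩ A) + K x' Aᶜ * μ B)
          + (ENNReal.ofReal δ + ENNReal.ofReal δ * μ B) := by ring
      _ ≤ ENNReal.ofReal (Real.exp ε) * (K x' (B ∩ A) + K x' Aᶜ * μ B)
          + ENNReal.ofReal (2 * δ) := by
          rw [two_mul, ENNReal.ofReal_add hδ hδ]
          gcongr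
          exact mul_le_of_le_one_right' prob_le_one

end
end

section
/- Let α ∈ (0,1), let m, n be positive integers, let 𝒳 and 𝒴_1, …, 𝒴_m be measurable spaces, let P_0 be a probability measure on 𝒳, let (Θ, π) be a probability space, and let f ↦ P_f be a Markov kernel from Θ to 𝒳. For a Markov kernel K from 𝒳^n to 𝒴_j and a probability measure P on 𝒳, write PK := ∫ K(·|x) dP^{⊗n}(x) (a probability measure on 𝒴_j). Let K^j and K̃^j be Markov kernels from 𝒳^n to 𝒴_j for j = 1,…,m, and suppose that for every j: TV(P_0 K^j, P_0 K̃^j) ≤ α/(2m), and TV(P_f K^j, P_f K̃^j) ≤ α/(2m) for π-almost every f ∈ Θ. Then for every measurable test T : 𝒴_1 × ⋯ × 𝒴_m → {0,1}: ∫ T d(⊗_{j=1}^m P_0 K^j) + ∫_Θ ∫ (1−T) d(⊗_{j=1}^m P_f K^j) dπ(f) ≥ ∫ T d(⊗_{j=1}^m P_0 K̃^j) + ∫_Θ ∫ (1−T) d(⊗_{j=1}^m P_f K̃^j) dπ(f) − α. -/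
open MeasureTheory ProbabilityTheory

noncomputable section

section TotalVariationPerturbation

variable {E F : Type*} [MeasurableSpace E] [MeasurableSpace F]

/-- Perturbing the first factor of a product by `ε` on every event perturbs the product by `ε`. -/
lemma prod_measure_le_add_of_left {μ ν : Measure E} [SFinite μ] [SFinite ν]
    (ρ : Measure F) [IsProbabilityMeasure ρ] {ε : ENNReal}
    (h : ∀ B, MeasurableSet B → μ B ≤ ν B + ε) {S : Set (E × F)} (hS : MeasurableSet S) :
    μ.prod ρ S ≤ ν.prod ρ S + ε := by
  rw [Measure.prod_apply_symm hS, Measure.prod_apply_symm hS]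
  calc ∫⁻ y, μ ((fun x => (x, y)) ⁻¹' S) ∂ρ
      ≤ ∫⁻ y, (ν ((fun x => (x, y)) ⁻¹' S) + ε) ∂ρ :=
        lintegral_mono fun y => h _ (measurable_prodMk_right hS)
    _ = _ := by rw [lintegral_add_right _ measurable_const]; simp

/-- Perturbing the second factor of a product by `ε` on every event perturbs the product by `ε`. -/
lemma prod_measure_le_add_of_right (μ : Measure E) [IsProbabilityMeasure μ]
    {ρ σ : Measure F} [SFinite ρ] [SFinite σ] {ε : ENNReal}
    (h : ∀ B, MeasurableSet B → ρ B ≤ σ B + ε) {S : Set (E × F)} (hS : MeasurableSet S) :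
    μ.prod ρ S ≤ μ.prod σ S + ε := by
  rw [Measure.prod_apply hS, Measure.prod_apply hS]
  calc ∫⁻ x, ρ (Prod.mk x ⁻¹' S) ∂μ
      ≤ ∫⁻ x, (σ (Prod.mk x ⁻¹' S) + ε) ∂μ :=
        lintegral_mono fun x => h _ (measurable_prodMk_left hS)
    _ = _ := by rw [lintegral_add_right _ measurable_const]; simp

/-- Subadditivity of total variation over product measures, in one-sided form. -/
lemma pi_measure_le_add {m : ℕ} {Y : Fin m → Type*} [∀ j, MeasurableSpace (Y j)]
    (μ ν : ∀ j, Measure (Y j)) [∀ j, IsProbabilityMeasure (μ j)]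
    [∀ j, IsProbabilityMeasure (ν j)] {ε : ENNReal}
    (h : ∀ j B, MeasurableSet B → μ j B ≤ ν j B + ε)
    {S : Set (∀ j, Y j)} (hS : MeasurableSet S) :
    Measure.pi μ S ≤ Measure.pi ν S + m * ε := by
  induction m with
  | zero => rw [Measure.pi_of_empty, Measure.pi_of_empty]; exact le_self_add
  | succ m ih =>
    let e := MeasurableEquiv.piFinSuccAbove Y 0
    have hS' : MeasurableSet (e.symm ⁻¹' S) := e.symm.measurable hS
    have key (ρ : ∀ j, Measure (Y j)) [∀ j, IsProbabilityMeasure (ρ j)] :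
        Measure.pi ρ S =
          (ρ 0).prod (Measure.pi fun j => ρ (Fin.succAbove 0 j)) (e.symm ⁻¹' S) :=
      ((measurePreserving_piFinSuccAbove ρ 0).symm.measure_preimage_equiv S).symm
    rw [key μ, key ν]
    calc _ ≤ (ν 0).prod (Measure.pi fun j => μ (Fin.succAbove 0 j)) (e.symm ⁻¹' S) + ε :=
          prod_measure_le_add_of_left _ (h 0) hS'
      _ ≤ (ν 0).prod (Measure.pi fun j => ν (Fin.succAbove 0 j)) (e.symm ⁻¹' S) + m * ε + ε := by
          gcongr
          exact prod_measure_le_add_of_right _ (fun B hB => ih _ _ (fun j => h _) hB) hS'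
      _ = _ := by push_cast; ring

end TotalVariationPerturbation

/-- **Testing risk is stable under total-variation approximation of the transcript kernels**:
if each local transcript distribution under the null and (π-a.e.) under the alternatives moves
by at most `α/(2m)` in total variation when the kernels `K^j` are replaced by `K̃^j`, the Bayes
testing risk decreases by at most `α`. -/
theorem testing_risk_kernel_approximation
    {𝒳 Θ : Type*} [MeasurableSpace 𝒳] [MeasurableSpace Θ]
    (m n : ℕ) (hm : 0 < m) (hn : 0 < n)
    (Y : Fin m → Type) [mY : ∀ j, MeasurableSpace (Y j)]
    (α : ℝ) (hα : α ∈ Set.Ioo (0 : ℝ) 1)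
    (P₀ : Measure 𝒳) (hP₀ : IsProbabilityMeasure P₀)
    (π : Measure Θ) (hπ : IsProbabilityMeasure π)
    (P : Kernel Θ 𝒳) (hP : IsMarkovKernel P)
    (K K' : ∀ j, Kernel (Fin n → 𝒳) (Y j))
    (hK : ∀ j, IsMarkovKernel (K j)) (hK' : ∀ j, IsMarkovKernel (K' j))
    -- TV(P₀ K^j, P₀ K̃^j) ≤ α/(2m)
    (htv0 : ∀ j, ∀ B : Set (Y j), MeasurableSet B →
      ((Measure.pi fun _ : Fin n => P₀).bind fun x => K j x) B ≤
          ((Measure.pi fun _ : Fin n => P₀).bind fun x => K' j x) B + ENNReal.ofReal (α / (2 * m)) ∧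
        ((Measure.pi fun _ : Fin n => P₀).bind fun x => K' j x) B ≤
          ((Measure.pi fun _ : Fin n => P₀).bind fun x => K j x) B + ENNReal.ofReal (α / (2 * m)))
    -- TV(P_f K^j, P_f K̃^j) ≤ α/(2m) for π-almost every f
    (htvf : ∀ j, ∀ᵐ f ∂π, ∀ B : Set (Y j), MeasurableSet B →
      ((Measure.pi fun _ : Fin n => P f).bind fun x => K j x) B ≤
          ((Measure.pi fun _ : Fin n => P f).bind fun x => K' j x) B + ENNReal.ofReal (α / (2 * m)) ∧
        ((Measure.pi fun _ : Fin n => P f).bind fun x => K' j x) B ≤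
          ((Measure.pi fun _ : Fin n => P f).bind fun x => K j x) B + ENNReal.ofReal (α / (2 * m)))
    (T : (∀ j, Y j) → Bool) (hT : Measurable T) :
    (Measure.pi fun j => (Measure.pi fun _ : Fin n => P₀).bind fun x => K' j x)
        { y | T y = true } +
      (∫⁻ f, (Measure.pi fun j => (Measure.pi fun _ : Fin n => P f).bind fun x => K' j x)
        { y | T y = false } ∂π) ≤
    (Measure.pi fun j => (Measure.pi fun _ : Fin n => P₀).bind fun x => K j x)
        { y | T y = true } +
      (∫⁻ f, (Measure.pi fun j => (Measure.pi fun _ : Fin n => P f).bind fun x => K j x)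
        { y | T y = false } ∂π) + ENNReal.ofReal α := by
  have hε : (m : ENNReal) * ENNReal.ofReal (α / (2 * m)) = ENNReal.ofReal (α / 2) := by
    have hm' : (m : ℝ) ≠ 0 := by positivity
    rw [← ENNReal.ofReal_natCast, ← ENNReal.ofReal_mul (by positivity)]
    congr 1
    field_simp
  have hbind (Q : Measure 𝒳) [IsProbabilityMeasure Q] (L : ∀ j, Kernel (Fin n → 𝒳) (Y j))
      [∀ j, IsMarkovKernel (L j)] (j : Fin m) :
      IsProbabilityMeasure ((Measure.pi fun _ : Fin n => Q).bind fun x => L j x) :=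
    inferInstanceAs (IsProbabilityMeasure ((Measure.pi fun _ : Fin n => Q).bind (L j)))
  have h0 := pi_measure_le_add _ _ (fun j B hB => (htv0 j B hB).2)
    (hT (measurableSet_singleton true))
  have hf : ∀ᵐ f ∂π,
      (Measure.pi fun j => (Measure.pi fun _ : Fin n => P f).bind fun x => K' j x)
        { y | T y = false } ≤
      (Measure.pi fun j => (Measure.pi fun _ : Fin n => P f).bind fun x => K j x)
        { y | T y = false } + ENNReal.ofReal (α / 2) := by
    filter_upwards [ae_all_iff.2 htvf] with f hf
    rw [← hε]
    exact pi_measure_le_add _ _ (fun j B hB => (hf j B hB).2)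
      (hT (measurableSet_singleton false))
  have h1 := lintegral_mono_ae hf
  rw [lintegral_add_right _ measurable_const, lintegral_const, measure_univ, mul_one] at h1
  rw [hε] at h0
  have hα2 : ENNReal.ofReal α = ENNReal.ofReal (α / 2) + ENNReal.ofReal (α / 2) := by
    rw [← ENNReal.ofReal_add (by linarith [hα.1]) (by linarith [hα.1]), add_halves]
  rw [hα2, add_add_add_comm]
  exact add_le_add h0 h1

end
end
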